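/- arXiv:1704.04285 — 5 statements merged into one kernel-verified Lean document; each statement's English description precedes it below -/
import Mathlib

section
/- Let A ∈ ℝ^{m×n}, u ∈ ℝ^m, v ∈ ℝ^n, and let σ ∈ ℝ be nonzero. Set B = A − σ^{-1} u vᵀ. Then rank(B) = rank(A) − 1 if and only if there exist vectors x ∈ ℝ^n and y ∈ ℝ^m such that u = A x, v = Aᵀ y, and σ = yᵀ A x (which is nonzero). -/
open Matrix

section RankOneUpdate

variable {K m n : Type*} [Field K] [Fintype n]

theorem range_mulVecLin_add_vecMulVec_le (B : Matrix m n K) (u : m → K) (v : n → K) :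
    (B + vecMulVec u v).mulVecLin.range ≤ B.mulVecLin.range ⊔ K ∙ u := by
  rintro _ ⟨z, rfl⟩
  rw [mulVecLin_apply, add_mulVec, vecMulVec_mulVec, op_smul_eq_smul]
  exact Submodule.add_mem_sup ⟨z, rfl⟩
    (Submodule.smul_mem _ _ (Submodule.mem_span_singleton_self u))

theorem notMem_range_of_rank_add_vecMulVec {B : Matrix m n K} {u : m → K} {v : n → K}
    (h : (B + vecMulVec u v).rank = B.rank + 1) : u ∉ B.mulVecLin.range := by
  intro hu
  have hle := Submodule.finrank_mono (range_mulVecLin_add_vecMulVec_le B u v)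
  rw [sup_eq_left.2 ((Submodule.span_singleton_le_iff_mem _ _).2 hu)] at hle
  simp only [rank] at h
  lia

variable [Finite m]

theorem rank_add_vecMulVec_eq_rank_add_one {B : Matrix m n K} {u : m → K} {v : n → K}
    (huB : u ∉ B.mulVecLin.range) (huA : u ∈ (B + vecMulVec u v).mulVecLin.range) :
    (B + vecMulVec u v).rank = B.rank + 1 := by
  have h : (B + vecMulVec u v).mulVecLin.range = B.mulVecLin.range ⊔ K ∙ u := by
    refine le_antisymm (range_mulVecLin_add_vecMulVec_le B u v) (sup_le ?_ ?_)
    · rintro _ ⟨z, rfl⟩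
      have hz : B.mulVecLin z = (B + vecMulVec u v).mulVecLin z - (v ⬝ᵥ z) • u := by
        simp [vecMulVec_mulVec]
      rw [hz]
      exact Submodule.sub_mem _ ⟨z, rfl⟩ (Submodule.smul_mem _ _ huA)
    · rwa [Submodule.span_singleton_le_iff_mem]
  rw [rank, h, Submodule.finrank_sup_span_singleton huB, rank]

theorem mem_range_of_rank_add_vecMulVec {B : Matrix m n K} {u : m → K} {v : n → K}
    (h : (B + vecMulVec u v).rank = B.rank + 1) :
    u ∈ (B + vecMulVec u v).mulVecLin.range := by
  rw [Submodule.eq_of_le_of_finrank_eq (range_mulVecLin_add_vecMulVec_le B u v)]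
  · exact Submodule.mem_sup_right (Submodule.mem_span_singleton_self u)
  · rw [Submodule.finrank_sup_span_singleton (notMem_range_of_rank_add_vecMulVec h)]
    exact h

end RankOneUpdate

/-- Egerváry rank-drop theorem.
Let `A ∈ ℝ^{m×n}`, `u ∈ ℝ^m`, `v ∈ ℝ^n`, and let `σ ≠ 0`.  Set `B = A - σ⁻¹ u vᵀ`.
Then `rank B = rank A - 1` (stated additively as `rank B + 1 = rank A`) if and only if
there exist `x ∈ ℝ^n` and `y ∈ ℝ^m` with `u = A x`, `v = Aᵀ y` and `σ = yᵀ A x`. -/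
theorem rank_drop_characterization {m n : ℕ}
    (A : Matrix (Fin m) (Fin n) ℝ) (u : Fin m → ℝ) (v : Fin n → ℝ)
    (σ : ℝ) (hσ : σ ≠ 0)
    (B : Matrix (Fin m) (Fin n) ℝ) (hB : B = A - σ⁻¹ • vecMulVec u v) :
    B.rank + 1 = A.rank ↔
      ∃ (x : Fin n → ℝ) (y : Fin m → ℝ),
        u = A.mulVec x ∧ v = Aᵀ.mulVec y ∧ σ = y ⬝ᵥ A.mulVec x := by
  have hA : A = B + vecMulVec u (σ⁻¹ • v) := by
    rw [hB, vecMulVec_smul, sub_add_cancel]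
  have hBz (z : Fin n → ℝ) : B *ᵥ z = A *ᵥ z - (σ⁻¹ * (v ⬝ᵥ z)) • u := by
    rw [hB, sub_mulVec, smul_mulVec, vecMulVec_mulVec, op_smul_eq_smul, smul_smul]
  constructor
  · intro h
    have hu : (B + vecMulVec u (σ⁻¹ • v)).rank = B.rank + 1 := by rw [← hA, h]
    have hAt : Aᵀ = Bᵀ + vecMulVec v (σ⁻¹ • u) := by
      rw [hA, transpose_add, transpose_vecMulVec, smul_vecMulVec, vecMulVec_smul]
    have hv : (Bᵀ + vecMulVec v (σ⁻¹ • u)).rank = Bᵀ.rank + 1 := by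
      rw [← hAt, rank_transpose, rank_transpose, h]
    obtain ⟨x, hx⟩ := mem_range_of_rank_add_vecMulVec hu
    obtain ⟨y, hy⟩ := mem_range_of_rank_add_vecMulVec hv
    rw [← hA, mulVecLin_apply] at hx
    rw [← hAt, mulVecLin_apply] at hy
    refine ⟨x, y, hx.symm, hy.symm, ?_⟩
    rw [dotProduct_mulVec, ← mulVec_transpose, hy]
    by_contra hne
    have hc : 1 - σ⁻¹ * (v ⬝ᵥ x) ≠ 0 := by
      intro h0
      rw [sub_eq_zero, eq_inv_mul_iff_mul_eq₀ hσ, mul_one] at h0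
      exact hne h0
    refine notMem_range_of_rank_add_vecMulVec hu ((Submodule.smul_mem_iff _ hc).1 ⟨x, ?_⟩)
    rw [mulVecLin_apply, hBz, hx, sub_smul, one_smul]
  · rintro ⟨x, y, hx, hy, hxy⟩
    have hu : u ∉ B.mulVecLin.range := by
      rintro ⟨z, hz⟩
      rw [mulVecLin_apply, hBz] at hz
      have hyz := congrArg (y ⬝ᵥ ·) hz
      simp only [dotProduct_sub, dotProduct_smul, smul_eq_mul] at hyz
      rw [dotProduct_mulVec, ← mulVec_transpose, ← hy, hx, ← hxy] at hyz
      field_simp at hyz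
      simp [hσ.symm] at hyz
    rw [hA, rank_add_vecMulVec_eq_rank_add_one hu]
    rw [← hA]
    exact ⟨x, hx.symm⟩
end

section
/- Let A ∈ ℝ^{m×n} have rank r and thin SVD A = U Σ Vᵀ. Then a matrix B belongs to the set of rank-drop steps R(A) if and only if there exist s, t ∈ ℝ^r with sᵀ Σ^{-1} t > 0 and B = (U s tᵀ Vᵀ)/(sᵀ Σ^{-1} t). That is, R(A) = { (U s tᵀ Vᵀ)/(sᵀ Σ^{-1} t) : s, t ∈ ℝ^r, sᵀ Σ^{-1} t > 0 }. -/
open Matrix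

/-- The set of rank-drop steps of a matrix `A`:
`R(A) = {σ⁻¹ u vᵀ : ∃ x, y, u = A x, v = Aᵀ y, σ = yᵀ A x ≠ 0}`. -/
def rankDropSet {m n : ℕ} (A : Matrix (Fin m) (Fin n) ℝ) :
    Set (Matrix (Fin m) (Fin n) ℝ) :=
  {B | ∃ (x : Fin n → ℝ) (y : Fin m → ℝ),
    y ⬝ᵥ A.mulVec x ≠ 0 ∧
    B = (y ⬝ᵥ A.mulVec x)⁻¹ • vecMulVec (A.mulVec x) (Aᵀ.mulVec y)}

/-- Lemma: rewriting the rank-drop set via a thin SVD.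
If `A` has rank `r` and thin SVD `A = U Σ Vᵀ` (orthonormal columns, positive decreasing
diagonal), then `R(A) = {(U s tᵀ Vᵀ)/(sᵀ Σ⁻¹ t) : s, t ∈ ℝ^r, sᵀ Σ⁻¹ t > 0}`. -/
theorem rankDropSet_eq_of_thinSVD {m n r : ℕ}
    (A : Matrix (Fin m) (Fin n) ℝ)
    (U : Matrix (Fin m) (Fin r) ℝ) (V : Matrix (Fin n) (Fin r) ℝ)
    (σ : Fin r → ℝ)
    (hU : Uᵀ * U = 1) (hV : Vᵀ * V = 1)
    (hpos : ∀ i, 0 < σ i) (hsorted : ∀ i j : Fin r, i ≤ j → σ j ≤ σ i)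
    (hA : A = U * diagonal σ * Vᵀ) (hrank : A.rank = r) :
    rankDropSet A =
      {B | ∃ s t : Fin r → ℝ,
        0 < s ⬝ᵥ (diagonal σ)⁻¹.mulVec t ∧
        B = (s ⬝ᵥ (diagonal σ)⁻¹.mulVec t)⁻¹ • vecMulVec (U.mulVec s) (V.mulVec t)} := by
  have hdet : IsUnit (diagonal σ).det := by
    rw [det_diagonal, isUnit_iff_ne_zero]
    exact Finset.prod_ne_zero_iff.2 fun i _ => (hpos i).ne'
  have hAx (x : Fin n → ℝ) : A *ᵥ x = U *ᵥ (diagonal σ *ᵥ (Vᵀ *ᵥ x)) := by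
    simp only [hA, mulVec_mulVec, Matrix.mul_assoc]
  have hAy (y : Fin m → ℝ) : Aᵀ *ᵥ y = V *ᵥ (diagonal σ *ᵥ (Uᵀ *ᵥ y)) := by
    simp only [hA, mulVec_mulVec, transpose_mul, transpose_transpose, diagonal_transpose]
  have hpair (x : Fin n → ℝ) (y : Fin m → ℝ) :
      y ⬝ᵥ A *ᵥ x =
        (diagonal σ *ᵥ (Vᵀ *ᵥ x)) ⬝ᵥ (diagonal σ)⁻¹ *ᵥ (diagonal σ *ᵥ (Uᵀ *ᵥ y)) := by
    rw [hAx, mulVec_mulVec (Uᵀ *ᵥ y), nonsing_inv_mul _ hdet, one_mulVec, dotProduct_mulVec,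
      ← mulVec_transpose, dotProduct_comm]
  ext B
  constructor
  · rintro ⟨x, y, hne, rfl⟩
    rw [hpair] at hne
    rw [hpair, hAx, hAy]
    generalize diagonal σ *ᵥ (Vᵀ *ᵥ x) = s at *
    generalize diagonal σ *ᵥ (Uᵀ *ᵥ y) = t at *
    rcases hne.lt_or_gt with hneg | hgt
    · refine ⟨-s, t, ?_, ?_⟩
      · rw [neg_dotProduct]
        exact neg_pos.2 hneg
      · rw [neg_dotProduct, mulVec_neg, neg_vecMulVec, inv_neg, neg_smul_neg]
    · exact ⟨s, t, hgt, rfl⟩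
  · rintro ⟨s, t, hgt, rfl⟩
    have hs : diagonal σ *ᵥ (Vᵀ *ᵥ (V *ᵥ ((diagonal σ)⁻¹ *ᵥ s))) = s := by
      rw [mulVec_mulVec _ Vᵀ, hV, one_mulVec, mulVec_mulVec, mul_nonsing_inv _ hdet, one_mulVec]
    have ht : diagonal σ *ᵥ (Uᵀ *ᵥ (U *ᵥ ((diagonal σ)⁻¹ *ᵥ t))) = t := by
      rw [mulVec_mulVec _ Uᵀ, hU, one_mulVec, mulVec_mulVec, mul_nonsing_inv _ hdet, one_mulVec]
    refine ⟨V *ᵥ ((diagonal σ)⁻¹ *ᵥ s), U *ᵥ ((diagonal σ)⁻¹ *ᵥ t), ?_, ?_⟩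
    · rw [hpair, hs, ht]
      exact hgt.ne'
    · rw [hpair, hAx, hAy, hs, ht]
end

section
/- Let D ∈ ℝ^{n×n} be symmetric positive semidefinite and S ∈ ℝ^{n×n} be symmetric, and suppose rank(D − S) = rank(D) − rank(S). Then D − S is positive semidefinite. -/
open Matrix

namespace Matrix

variable {K m n : Type*} [Field K] [Fintype n]

/-- If rank is additive on `A + B`, then the column space of `A + B` is the sum of those of `A`
and `B`. -/
lemma range_add_mulVecLin_eq_sup {A B : Matrix m n K} (h : A.rank + B.rank = (A + B).rank) :
    (A + B).mulVecLin.range = A.mulVecLin.range ⊔ B.mulVecLin.range := by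
  refine Submodule.eq_of_le_of_finrank_le ?_ ?_
  · rw [mulVecLin_add]
    exact LinearMap.range_add_le _ _
  · exact (Submodule.finrank_add_le_finrank_add_finrank _ _).trans h.le

/-- If rank is additive on `A + B`, then the column spaces of `A` and `B` are disjoint. -/
lemma disjoint_range_mulVecLin {A B : Matrix m n K} (h : A.rank + B.rank = (A + B).rank) :
    Disjoint A.mulVecLin.range B.mulVecLin.range := by
  have hdim := Submodule.finrank_sup_add_finrank_inf_eq A.mulVecLin.range B.mulVecLin.range
  rw [← range_add_mulVecLin_eq_sup h] at hdim
  simp only [Matrix.rank] at h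
  rw [disjoint_iff, ← Submodule.finrank_eq_zero (R := K)]
  omega

/-- If rank is additive on `A + B`, then modulo the kernel of `A` every vector lies in the kernel
of `B`. -/
lemma exists_mulVec_eq_and_mulVec_eq_zero {A B : Matrix m n K}
    (h : A.rank + B.rank = (A + B).rank) (x : n → K) :
    ∃ y, A *ᵥ y = A *ᵥ x ∧ B *ᵥ y = 0 := by
  have hx : A *ᵥ x ∈ (A + B).mulVecLin.range := by
    rw [range_add_mulVecLin_eq_sup h]
    exact Submodule.mem_sup_left ⟨x, rfl⟩
  obtain ⟨y, hy⟩ := hx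
  rw [mulVecLin_apply, add_mulVec] at hy
  have hB : B *ᵥ y = 0 := by
    refine Submodule.disjoint_def.mp (disjoint_range_mulVecLin h) _ ⟨x - y, ?_⟩ ⟨y, rfl⟩
    rw [mulVecLin_apply, mulVec_sub, ← hy, add_sub_cancel_left]
  exact ⟨y, by simpa [hB] using hy, hB⟩

end Matrix

/-- Chu's theorem.
Let `D` be symmetric positive semidefinite and `S` symmetric with
`rank (D - S) = rank D - rank S` (stated additively as
`rank (D - S) + rank S = rank D`).  Then `D - S` is positive semidefinite. -/
theorem posSemidef_sub_of_rank_sub {n : ℕ}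
    (D S : Matrix (Fin n) (Fin n) ℝ)
    (hD : D.PosSemidef) (hS : S.IsSymm)
    (hrank : (D - S).rank + S.rank = D.rank) :
    (D - S).PosSemidef := by
  have hDsymm : D.IsSymm := by
    simpa [IsHermitian, IsSymm, conjTranspose_eq_transpose_of_trivial] using hD.isHermitian
  have hA : (D - S).IsSymm := hDsymm.sub hS
  refine .of_dotProduct_mulVec_nonneg
    ((conjTranspose_eq_transpose_of_trivial _).trans hA) fun x ↦ ?_
  obtain ⟨y, hAy, hSy⟩ := exists_mulVec_eq_and_mulVec_eq_zero
    (A := D - S) (B := S) (by rw [sub_add_cancel, hrank]) x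
  have hswap : x ⬝ᵥ (D - S) *ᵥ y = y ⬝ᵥ (D - S) *ᵥ x := by
    rw [dotProduct_mulVec, ← mulVec_transpose, hA.eq, dotProduct_comm]
  have hDy : (D - S) *ᵥ y = D *ᵥ y := by rw [sub_mulVec, hSy, sub_zero]
  rw [star_trivial, ← hAy, hswap, ← hAy, hDy]
  simpa using hD.dotProduct_mulVec_nonneg y
end

section
/- Let W ∈ ℝ^{r×r}, let Σ ∈ ℝ^{r×r} be diagonal with positive diagonal entries, and let κ > 0. Suppose s, t ∈ ℝ^r and λ, α, β ∈ ℝ satisfy the KKT conditions of the interior rank-drop problem: stationarity Wᵀ s + λ Σ^{-1} s = −2β t and W t + λ Σ^{-1} t = −2α s, primal feasibility sᵀ Σ^{-1} t = κ^{-1}, ‖s‖₂ = 1, ‖t‖₂ ≤ 1, and complementary slackness β(tᵀ t − 1) = 0. If in addition ‖t‖₂ < 1, then α = β = 0, λ is an eigenvalue of −Σ W, and the matrix M_λ := −(1/2)(W + λ Σ^{-1}) is singular, i.e., has zero as a singular value. -/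
open Matrix

/-- The Euclidean norm of a vector in `ℝ^r`. -/
noncomputable def euclNorm {r : ℕ} (s : Fin r → ℝ) : ℝ := Real.sqrt (s ⬝ᵥ s)

/-- Theorem: characterization of KKT points of the interior
rank-drop problem.  Suppose `(s, t, λ, α, β)` satisfies the KKT conditions of the
interior rank-drop problem: stationarity `Wᵀ s + λ Σ⁻¹ s = -2β t` and
`W t + λ Σ⁻¹ t = -2α s`, primal feasibility `sᵀ Σ⁻¹ t = κ⁻¹`, `‖s‖₂ = 1`, `‖t‖₂ ≤ 1`,
and complementary slackness `β (tᵀ t - 1) = 0`.  If `‖t‖₂ < 1`, then `α = β = 0`,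
`λ` is an eigenvalue of `-Σ W`, and `M_λ := -(1/2)(W + λ Σ⁻¹)` is singular
(has zero as a singular value, i.e. determinant zero). -/
theorem kkt_interior_characterization {r : ℕ}
    (W : Matrix (Fin r) (Fin r) ℝ)
    (σ : Fin r → ℝ) (hpos : ∀ i, 0 < σ i)
    (κ : ℝ) (hκ : 0 < κ)
    (s t : Fin r → ℝ) (lam α β : ℝ)
    (hstat1 : Wᵀ.mulVec s + lam • (diagonal σ)⁻¹.mulVec s = (-2 * β) • t)
    (hstat2 : W.mulVec t + lam • (diagonal σ)⁻¹.mulVec t = (-2 * α) • s)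
    (hfeas : s ⬝ᵥ (diagonal σ)⁻¹.mulVec t = κ⁻¹)
    (hsnorm : euclNorm s = 1) (htnorm : euclNorm t ≤ 1)
    (hcs : β * (t ⬝ᵥ t - 1) = 0)
    (htlt : euclNorm t < 1) :
    α = 0 ∧ β = 0 ∧
    (∃ x : Fin r → ℝ, x ≠ 0 ∧ (-(diagonal σ * W)).mulVec x = lam • x) ∧
    ((-(1 / 2 : ℝ)) • (W + lam • (diagonal σ)⁻¹)).det = 0 := by
  have hs : s ⬝ᵥ s = 1 := by
    simpa [euclNorm] using hsnorm
  have ht : t ⬝ᵥ t < 1 := by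
    simpa [euclNorm, Real.sqrt_lt'] using htlt
  have hβ : β = 0 := by
    rcases mul_eq_zero.mp hcs with h | h
    · exact h
    · linarith
  have hdet : IsUnit (diagonal σ).det := by
    rw [det_diagonal]
    exact (Finset.prod_pos fun i _ => hpos i).ne'.isUnit
  have hsymm : ((diagonal σ)⁻¹)ᵀ = (diagonal σ)⁻¹ := by
    rw [transpose_nonsing_inv, diagonal_transpose]
  rw [← smul_mulVec, ← add_mulVec] at hstat1 hstat2
  have hleft : s ᵥ* (W + lam • (diagonal σ)⁻¹) = 0 := by
    rw [← mulVec_transpose, transpose_add, transpose_smul, hsymm, hstat1, hβ]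
    simp
  have hα : α = 0 := by
    have h := dotProduct_mulVec s (W + lam • (diagonal σ)⁻¹) t
    rw [hleft, hstat2, zero_dotProduct, dotProduct_smul, hs, smul_eq_mul] at h
    linarith
  have htne : t ≠ 0 := by
    rintro rfl
    rw [mulVec_zero, dotProduct_zero] at hfeas
    exact (inv_pos.mpr hκ).ne hfeas
  have hker : (W + lam • (diagonal σ)⁻¹) *ᵥ t = 0 := by
    rw [hstat2, hα]
    simp
  refine ⟨hα, hβ, ⟨t, htne, ?_⟩, ?_⟩
  · have h := congrArg (diagonal σ *ᵥ ·) hker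
    simp only [add_mulVec, smul_mulVec, mulVec_add, mulVec_smul, mulVec_mulVec,
      mul_nonsing_inv _ hdet, one_mulVec, mulVec_zero] at h
    rw [neg_mulVec, neg_eq_iff_add_eq_zero, h]
  · exact exists_mulVec_eq_zero_iff.mp ⟨t, htne, by rw [smul_mulVec, hker, smul_zero]⟩
end

section
/- Let W ∈ ℝ^{r×r}, let Σ ∈ ℝ^{r×r} be diagonal with positive diagonal entries, let κ > 0, and let λ ∈ ℝ. Suppose ŝ, t̂ ∈ ℝ^r are unit vectors forming a singular vector pair of M_λ := −(1/2)(W + λ Σ^{-1}) associated with the singular value zero (i.e., M_λ t̂ = 0 and M_λᵀ ŝ = 0), and suppose κ ŝᵀ Σ^{-1} t̂ > 1. Then, with t := t̂/(κ ŝᵀ Σ^{-1} t̂), the tuple (ŝ, t, λ, 0, 0) satisfies the KKT conditions of the interior rank-drop problem: Wᵀ ŝ + λ Σ^{-1} ŝ = 0, W t + λ Σ^{-1} t = 0, ŝᵀ Σ^{-1} t = κ^{-1}, ‖ŝ‖₂ = 1, and ‖t‖₂ < 1. -/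
open Matrix

theorem euclNorm_smul {r : ℕ} (c : ℝ) (s : Fin r → ℝ) :
    euclNorm (c • s) = |c| * euclNorm s := by
  rw [euclNorm, euclNorm, smul_dotProduct, dotProduct_smul, smul_eq_mul, smul_eq_mul,
    ← mul_assoc, ← sq, Real.sqrt_mul (sq_nonneg c), Real.sqrt_sq_eq_abs]

/-- Theorem: converse construction of KKT points of the interior
rank-drop problem.  Let `λ ∈ ℝ` and suppose the unit vectors `ŝ, t̂` form a singular
vector pair of `M_λ := -(1/2)(W + λ Σ⁻¹)` associated with the singular value zero
(`M_λ t̂ = 0` and `M_λᵀ ŝ = 0`), with `κ ŝᵀ Σ⁻¹ t̂ > 1`.  Then, with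
`t = t̂ / (κ ŝᵀ Σ⁻¹ t̂)`, the tuple `(ŝ, t, λ, 0, 0)` satisfies the KKT conditions:
`Wᵀ ŝ + λ Σ⁻¹ ŝ = 0`, `W t + λ Σ⁻¹ t = 0`, `ŝᵀ Σ⁻¹ t = κ⁻¹`, `‖ŝ‖₂ = 1`, `‖t‖₂ < 1`. -/
theorem kkt_interior_converse {r : ℕ}
    (W : Matrix (Fin r) (Fin r) ℝ)
    (σ : Fin r → ℝ) (hpos : ∀ i, 0 < σ i)
    (κ : ℝ) (hκ : 0 < κ) (lam : ℝ)
    (sHat tHat : Fin r → ℝ)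
    (hsnorm : euclNorm sHat = 1) (htnorm : euclNorm tHat = 1)
    (h1 : ((-(1 / 2 : ℝ)) • (W + lam • (diagonal σ)⁻¹)).mulVec tHat = 0)
    (h2 : ((-(1 / 2 : ℝ)) • (W + lam • (diagonal σ)⁻¹))ᵀ.mulVec sHat = 0)
    (hgt : 1 < κ * (sHat ⬝ᵥ (diagonal σ)⁻¹.mulVec tHat))
    (t : Fin r → ℝ)
    (ht : t = (κ * (sHat ⬝ᵥ (diagonal σ)⁻¹.mulVec tHat))⁻¹ • tHat) :
    Wᵀ.mulVec sHat + lam • (diagonal σ)⁻¹.mulVec sHat = 0 ∧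
    W.mulVec t + lam • (diagonal σ)⁻¹.mulVec t = 0 ∧
    sHat ⬝ᵥ (diagonal σ)⁻¹.mulVec t = κ⁻¹ ∧
    euclNorm sHat = 1 ∧
    euclNorm t < 1 := by
  have hker : W *ᵥ tHat + lam • (diagonal σ)⁻¹ *ᵥ tHat = 0 := by
    rw [smul_mulVec, smul_eq_zero_iff_right (by norm_num)] at h1
    rwa [add_mulVec, smul_mulVec] at h1
  refine ⟨?_, ?_, ?_, hsnorm, ?_⟩
  · rw [transpose_smul, smul_mulVec, smul_eq_zero_iff_right (by norm_num)] at h2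
    rwa [transpose_add, transpose_smul, transpose_nonsing_inv, diagonal_transpose,
      add_mulVec, smul_mulVec] at h2
  · rw [ht, mulVec_smul, mulVec_smul, smul_comm lam, ← smul_add, hker, smul_zero]
  · have hne : sHat ⬝ᵥ (diagonal σ)⁻¹ *ᵥ tHat ≠ 0 := by
      intro h
      rw [h, mul_zero] at hgt
      exact not_lt_of_ge zero_le_one hgt
    rw [ht, mulVec_smul, dotProduct_smul, smul_eq_mul]
    field_simp
  · rw [ht, euclNorm_smul, htnorm, mul_one, abs_inv, abs_of_pos (zero_lt_one.trans hgt)]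
    exact inv_lt_one_of_one_lt₀ hgt
end
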